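/- Let (X,d,μ) be a metric space with a σ-finite Borel measure, let D_1,…,D_n be derivations on (X,d,μ) that are linearly independent over L∞(μ), and let {g_j}_{j=1}^∞ be a countable set of bounded Lipschitz functions that sequentially generates the bounded Lipschitz functions on X and satisfies sup_j max(sup_X|g_j|, L(g_j)) ≤ C < ∞. Then for μ-a.e. x ∈ X the n sequences (D_i g_j(x))_{j=1}^∞ ∈ ℓ^∞(ℕ), i = 1,…,n, are linearly independent over ℝ; moreover there exist a subset {g'_1,…,g'_n} ⊆ {g_j}_j, a measurable V ⊆ X with μ(V) > 0, and measurable μ-essentially bounded functions a_{ik} : V → ℝ with (a_{ik}(x)) invertible for μ-a.e. x ∈ V, such that the derivations D'_i := Σ_{k=1}^n a_{ik}·D_k (restricted to V) satisfy D'_i g'_j(x) = δ_{ij} for μ-a.e. x ∈ V. -/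

import Mathlib

open MeasureTheory Metric Filter Set Topology
open scoped ENNReal NNReal

noncomputable section

/-- `f` is a bounded Lipschitz function. -/
def IsBddLipschitz {X : Type*} [PseudoMetricSpace X] (f : X → ℝ) : Prop :=
  (∃ K : ℝ≥0, LipschitzWith K f) ∧ ∃ M : ℝ, ∀ x, |f x| ≤ M

/-- The global Lipschitz constant of `f`. -/
def glip {X : Type*} [PseudoMetricSpace X] (f : X → ℝ) : ℝ :=
  sInf {K : ℝ | 0 ≤ K ∧ ∀ x y, |f x - f y| ≤ K * dist x y}

/-- `max (sup_X |f|) (global Lipschitz constant of f)`. -/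
def lipNorm {X : Type*} [PseudoMetricSpace X] (f : X → ℝ) : ℝ :=
  max (⨆ x, |f x|) (glip f)

/-- The variation of `f` on the open ball `B(x,r)`:
`varlip f x r = r⁻¹ · sup_{y ∈ B(x,r)} |f x - f y|`. -/
def varlip {X : Type*} [PseudoMetricSpace X] (f : X → ℝ) (x : X) (r : ℝ) : ℝ :=
  r⁻¹ * sSup ((fun y => |f x - f y|) '' ball x r)

/-- The upper variation of `f` at `x` from scale `r` down to `0`:
`Lip f (x,r) = sup_{0 < s ≤ r} varlip f x s`. -/
def bigLipR {X : Type*} [PseudoMetricSpace X] (f : X → ℝ) (x : X) (r : ℝ) : ℝ :=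
  ⨆ s : Ioc (0:ℝ) r, varlip f x s.1

/-- The lower variation of `f` at `x` from scale `r` down to `0`:
`lip f (x,r) = inf_{0 < s ≤ r} varlip f x s`. -/
def smlLipR {X : Type*} [PseudoMetricSpace X] (f : X → ℝ) (x : X) (r : ℝ) : ℝ :=
  ⨅ s : Ioc (0:ℝ) r, varlip f x s.1

/-- The pointwise upper Lipschitz constant
`Lip f (x) = inf_{r>0} sup_{0<s≤r} varlip f x s`. -/
def bigLip {X : Type*} [PseudoMetricSpace X] (f : X → ℝ) (x : X) : ℝ :=
  ⨅ r : Ioi (0:ℝ), bigLipR f x r.1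

/-- The pointwise lower Lipschitz constant
`lip f (x) = sup_{r>0} inf_{0<s≤r} varlip f x s`. -/
def smlLip {X : Type*} [PseudoMetricSpace X] (f : X → ℝ) (x : X) : ℝ :=
  ⨆ r : Ioi (0:ℝ), smlLipR f x r.1

/-- A derivation on the metric measure space `(X,d,μ)`: a linear, bounded operator
from bounded Lipschitz functions to measurable essentially bounded functions that
satisfies the Leibniz rule and is weak* sequentially continuous. -/
structure MDerivation (X : Type*) [PseudoMetricSpace X] [MeasurableSpace X]
    (μ : MeasureTheory.Measure X) where
  D : (X → ℝ) → (X → ℝ)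
  C : ℝ
  C_nonneg : 0 ≤ C
  measurable_D : ∀ f, IsBddLipschitz f → Measurable (D f)
  linear : ∀ (a b : ℝ) (f g : X → ℝ), IsBddLipschitz f → IsBddLipschitz g →
      ∀ᵐ x ∂μ, D (fun y => a * f y + b * g y) x = a * D f x + b * D g x
  bound : ∀ f, IsBddLipschitz f → ∀ᵐ x ∂μ, |D f x| ≤ C * lipNorm f
  leibniz : ∀ f g, IsBddLipschitz f → IsBddLipschitz g →
      ∀ᵐ x ∂μ, D (fun y => f y * g y) x = f x * D g x + g x * D f x
  weakStar : ∀ (F : ℕ → X → ℝ) (f : X → ℝ), (∀ n, IsBddLipschitz (F n)) →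
      IsBddLipschitz f → (∃ B : ℝ, ∀ n, lipNorm (F n) ≤ B) →
      (∀ x, Tendsto (fun n => F n x) atTop (𝓝 (f x))) →
      ∀ g : X → ℝ, Integrable g μ →
        Tendsto (fun n => ∫ x, D (F n) x * g x ∂μ) atTop (𝓝 (∫ x, D f x * g x ∂μ))

/-- The derivations `D_1,…,D_n` are linearly independent over `L∞(μ)`. -/
def LinIndepDer {X : Type*} [PseudoMetricSpace X] [MeasurableSpace X]
    (μ : MeasureTheory.Measure X) {n : ℕ} (Ds : Fin n → MDerivation X μ) : Prop :=
  ∀ lam : Fin n → X → ℝ, (∀ i, Measurable (lam i)) →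
    (∀ i, ∃ M : ℝ, ∀ᵐ x ∂μ, |lam i x| ≤ M) →
    (∀ f, IsBddLipschitz f → ∀ᵐ x ∂μ, (∑ i, lam i x * (Ds i).D f x) = 0) →
    ∀ i, ∀ᵐ x ∂μ, lam i x = 0

/-- `G` sequentially generates the bounded Lipschitz functions: every bounded
Lipschitz function is the pointwise limit of a sequence, with uniformly bounded
Lipschitz norms, from the unital `ℝ`-subalgebra generated by `G`. -/
def SeqGenerates {X : Type*} [PseudoMetricSpace X] (G : Set (X → ℝ)) : Prop :=
  ∀ f : X → ℝ, IsBddLipschitz f → ∃ p : ℕ → X → ℝ,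
    (∀ k, p k ∈ Algebra.adjoin ℝ G) ∧ (∃ B : ℝ, ∀ k, lipNorm (p k) ≤ B) ∧
    ∀ x, Tendsto (fun k => p k x) atTop (𝓝 (f x))

namespace IsBddLipschitz

variable {X : Type*} [PseudoMetricSpace X] {f g : X → ℝ}

lemma const (c : ℝ) : IsBddLipschitz (fun _ : X => c) :=
  ⟨⟨0, LipschitzWith.const c⟩, |c|, fun _ => le_rfl⟩

lemma add (hf : IsBddLipschitz f) (hg : IsBddLipschitz g) :
    IsBddLipschitz (fun x => f x + g x) := by
  obtain ⟨⟨K, hK⟩, M, hM⟩ := hf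
  obtain ⟨⟨L, hL⟩, N, hN⟩ := hg
  exact ⟨⟨K + L, hK.add hL⟩, M + N, fun x =>
    (abs_add_le _ _).trans (add_le_add (hM x) (hN x))⟩

lemma mul (hf : IsBddLipschitz f) (hg : IsBddLipschitz g) :
    IsBddLipschitz (fun x => f x * g x) := by
  obtain ⟨⟨K, hK⟩, M, hM⟩ := hf
  obtain ⟨⟨L, hL⟩, N, hN⟩ := hg
  refine ⟨⟨M.toNNReal * L + N.toNNReal * K, LipschitzWith.of_dist_le_mul fun x y => ?_⟩,
    M * N, fun x => ?_⟩
  · have hM0 : 0 ≤ M := (abs_nonneg _).trans (hM x)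
    have hN0 : 0 ≤ N := (abs_nonneg _).trans (hN x)
    have h₁ := hK.dist_le_mul x y
    have h₂ := hL.dist_le_mul x y
    simp only [Real.dist_eq, NNReal.coe_add, NNReal.coe_mul, Real.coe_toNNReal _ hM0,
      Real.coe_toNNReal _ hN0] at *
    calc |f x * g x - f y * g y| = |f x * (g x - g y) + g y * (f x - f y)| := by ring_nf
      _ ≤ |f x| * |g x - g y| + |g y| * |f x - f y| := by
        rw [← abs_mul, ← abs_mul]; exact abs_add_le _ _
      _ ≤ M * (L * dist x y) + N * (K * dist x y) := by
        gcongr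
        · exact hM x
        · exact hN y
      _ = (M * L + N * K) * dist x y := by ring
  · rw [abs_mul]
    exact mul_le_mul (hM x) (hN x) (abs_nonneg _) ((abs_nonneg _).trans (hM x))

lemma of_mem_adjoin {G : Set (X → ℝ)} (hG : ∀ f ∈ G, IsBddLipschitz f)
    (hf : f ∈ Algebra.adjoin ℝ G) : IsBddLipschitz f := by
  induction hf using Algebra.adjoin_induction with
  | mem f hf => exact hG f hf
  | algebraMap r => exact const r
  | add f g _ _ hf hg => exact hf.add hg
  | mul f g _ _ hf hg => exact hf.mul hg

end IsBddLipschitz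

namespace MDerivation

variable {X : Type*} [PseudoMetricSpace X] [MeasurableSpace X] {μ : Measure X}

lemma ae_const_eq_zero (δ : MDerivation X μ) (c : ℝ) : ∀ᵐ x ∂μ, δ.D (fun _ => c) x = 0 := by
  have h₁ := IsBddLipschitz.const (X := X) 1
  filter_upwards [δ.leibniz _ _ h₁ h₁, δ.linear c 0 _ _ h₁ h₁] with x hx hx'
  simp only [mul_one, one_mul, zero_mul, add_zero] at hx hx'
  rw [hx', show δ.D (fun _ => 1) x = 0 by linarith, mul_zero]

lemma ae_add (δ : MDerivation X μ) {f g : X → ℝ} (hf : IsBddLipschitz f)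
    (hg : IsBddLipschitz g) : ∀ᵐ x ∂μ, δ.D (fun y => f y + g y) x = δ.D f x + δ.D g x := by
  simpa using δ.linear 1 1 f g hf hg

variable {ι : Type*} [Fintype ι]

/-- A combination of derivations that kills a set kills the algebra it generates. -/
lemma ae_sum_eq_zero_of_mem_adjoin (δ : ι → MDerivation X μ) (c : ι → X → ℝ)
    {G : Set (X → ℝ)} (hG : ∀ f ∈ G, IsBddLipschitz f)
    (h : ∀ f ∈ G, ∀ᵐ x ∂μ, ∑ i, c i x * (δ i).D f x = 0) {f : X → ℝ}
    (hf : f ∈ Algebra.adjoin ℝ G) : ∀ᵐ x ∂μ, ∑ i, c i x * (δ i).D f x = 0 := by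
  induction hf using Algebra.adjoin_induction with
  | mem f hf => exact h f hf
  | algebraMap r =>
    filter_upwards [ae_all_iff.2 fun i => (δ i).ae_const_eq_zero r] with x hx
    exact Finset.sum_eq_zero fun i _ => mul_eq_zero_of_right _ (hx i)
  | add f g hf hg ihf ihg =>
    filter_upwards [ihf, ihg, ae_all_iff.2 fun i =>
      (δ i).ae_add (.of_mem_adjoin hG hf) (.of_mem_adjoin hG hg)] with x h₁ h₂ hx
    calc ∑ i, c i x * (δ i).D (f + g) x
        = ∑ i, (c i x * (δ i).D f x + c i x * (δ i).D g x) :=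
          Finset.sum_congr rfl fun i _ => by rw [← mul_add, ← hx i]; rfl
      _ = 0 := by rw [Finset.sum_add_distrib, h₁, h₂, add_zero]
  | mul f g hf hg ihf ihg =>
    filter_upwards [ihf, ihg, ae_all_iff.2 fun i =>
      (δ i).leibniz f g (.of_mem_adjoin hG hf) (.of_mem_adjoin hG hg)] with x h₁ h₂ hx
    calc ∑ i, c i x * (δ i).D (f * g) x
        = ∑ i, (f x * (c i x * (δ i).D g x) + g x * (c i x * (δ i).D f x)) :=
          Finset.sum_congr rfl fun i _ => by
            rw [show (δ i).D (f * g) x = _ from hx i]; ring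
      _ = 0 := by
        rw [Finset.sum_add_distrib, ← Finset.mul_sum, ← Finset.mul_sum, h₁, h₂]; simp

/-- A bounded combination of derivations that kills a sequentially generating
set vanishes on all bounded Lipschitz functions. -/
lemma ae_sum_eq_zero_of_seqGenerates [SigmaFinite μ] (δ : ι → MDerivation X μ)
    (c : ι → X → ℝ) (hc : ∀ i, Measurable (c i)) (M : ℝ) (hM : ∀ i x, |c i x| ≤ M)
    {G : Set (X → ℝ)} (hG : ∀ f ∈ G, IsBddLipschitz f) (hgen : SeqGenerates G)
    (h : ∀ f ∈ G, ∀ᵐ x ∂μ, ∑ i, c i x * (δ i).D f x = 0) {f : X → ℝ}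
    (hf : IsBddLipschitz f) : ∀ᵐ x ∂μ, ∑ i, c i x * (δ i).D f x = 0 := by
  obtain ⟨p, hp, hB, hlim⟩ := hgen f hf
  have hpL k : IsBddLipschitz (p k) := .of_mem_adjoin hG (hp k)
  have hci {i : ι} {s : Set X} (hs : MeasurableSet s) (hμs : μ s < ∞) :
      Integrable (s.indicator (c i)) μ := by
    rw [integrable_indicator_iff hs]
    exact Measure.integrableOn_of_bounded hμs.ne (hc i).aestronglyMeasurable
      (.of_forall fun x => hM i x)
  have hint {i : ι} {u : X → ℝ} (hu : IsBddLipschitz u) {s : Set X} (hs : MeasurableSet s)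
      (hμs : μ s < ∞) :
      Integrable (fun x => (δ i).D u x * s.indicator (c i) x) μ :=
    (hci hs hμs).bdd_mul (c := (δ i).C * lipNorm u)
      ((δ i).measurable_D u hu).aestronglyMeasurable ((δ i).bound u hu)
  have hsum {u : X → ℝ} {s : Set X} : (fun x => ∑ i, (δ i).D u x * s.indicator (c i) x)
      = s.indicator fun x => ∑ i, c i x * (δ i).D u x := by
    ext x
    by_cases hx : x ∈ s <;> simp [hx, mul_comm]
  refine ae_eq_zero_of_forall_setIntegral_eq_of_sigmaFinite (fun s hs hμs => ?_)
    fun s hs hμs => ?_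
  · rw [← integrable_indicator_iff hs, ← hsum]
    exact integrable_finsetSum _ fun i _ => hint hf hs hμs
  · rw [← integral_indicator hs, ← hsum, integral_finsetSum _ fun i _ => hint hf hs hμs]
    refine tendsto_nhds_unique (tendsto_finsetSum _ fun i _ =>
      (δ i).weakStar p f hpL hf hB hlim _ (hci (i := i) hs hμs)) ?_
    refine tendsto_const_nhds.congr fun k => ?_
    rw [← integral_finsetSum _ fun i _ => hint (hpL k) hs hμs, hsum, integral_indicator hs]
    refine (integral_eq_zero_of_ae (ae_restrict_of_ae ?_)).symm
    exact ae_sum_eq_zero_of_mem_adjoin δ c hG h (hp k)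

end MDerivation

namespace LinIndepDer

variable {X : Type*} [PseudoMetricSpace X] [MeasurableSpace X] {μ : Measure X} [SigmaFinite μ]
  {n : ℕ} {Ds : Fin n → MDerivation X μ}

/-- Coefficients that are merely measurable can be tested against a sequentially generating
set only. -/
lemma ae_eq_zero (hind : LinIndepDer μ Ds) {G : Set (X → ℝ)}
    (hG : ∀ f ∈ G, IsBddLipschitz f) (hgen : SeqGenerates G)
    (c : Fin n → X → ℝ) (hc : ∀ i, Measurable (c i))
    (h : ∀ f ∈ G, ∀ᵐ x ∂μ, ∑ i, c i x * (Ds i).D f x = 0) (i : Fin n) :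
    ∀ᵐ x ∂μ, c i x = 0 := by
  set N : X → ℝ := fun x => 1 + ∑ i, |c i x|
  have hN x : 0 < N x := by positivity
  have hNm : Measurable N := by fun_prop
  have hle i x : |c i x / N x| ≤ 1 := by
    rw [abs_div, abs_of_pos (hN x), div_le_one (hN x)]
    have := Finset.single_le_sum (f := fun i => |c i x|) (fun _ _ => abs_nonneg _)
      (Finset.mem_univ i)
    simp only [N]
    linarith
  have hm i : Measurable fun x => c i x / N x := (hc i).div hNm
  have key := hind (fun i x => c i x / N x) hm (fun i => ⟨1, .of_forall (hle i)⟩)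
    (fun f hf => MDerivation.ae_sum_eq_zero_of_seqGenerates Ds _ hm 1 hle hG hgen
      (fun f hf => ?_) hf) i
  · filter_upwards [key] with x hx
    simpa [(hN x).ne'] using hx
  · filter_upwards [h f hf] with x hx
    simp_rw [div_mul_eq_mul_div]
    rw [← Finset.sum_div, hx, zero_div]

end LinIndepDer

lemma Measurable.matrix_det {X ι : Type*} [MeasurableSpace X] [Fintype ι] [DecidableEq ι]
    {A : X → Matrix ι ι ℝ} (hA : ∀ i j, Measurable fun x => A x i j) :
    Measurable fun x => (A x).det := by
  simp_rw [Matrix.det_apply']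
  exact Finset.measurable_sum _ fun σ _ =>
    (Finset.measurable_prod _ fun i _ => hA _ _).const_mul _

lemma Measurable.matrix_inv_apply {X ι : Type*} [MeasurableSpace X] [Fintype ι] [DecidableEq ι]
    {A : X → Matrix ι ι ℝ} (hA : ∀ i j, Measurable fun x => A x i j) (i j : ι) :
    Measurable fun x => (A x)⁻¹ i j := by
  simp_rw [Matrix.inv_def, Ring.inverse_eq_inv', Matrix.smul_apply, Matrix.adjugate_apply,
    smul_eq_mul]
  refine (Measurable.matrix_det hA).inv.mul (Measurable.matrix_det fun k l => ?_)
  by_cases hk : k = j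
  · subst hk; simp
  · simpa [Matrix.updateRow_ne hk] using hA k l

/-- The matrix of the derivatives of `g (σ b)` along `Ds (ρ a)` at `x`. -/
def derMatrix {X : Type*} [PseudoMetricSpace X] [MeasurableSpace X] {μ : Measure X} {n r : ℕ}
    (Ds : Fin n → MDerivation X μ) (g : ℕ → X → ℝ) (ρ : Fin r → Fin n) (σ : Fin r → ℕ)
    (x : X) : Matrix (Fin r) (Fin r) ℝ :=
  Matrix.of fun a b => (Ds (ρ a)).D (g (σ b)) x

section derMatrix

variable {X : Type*} [PseudoMetricSpace X] [MeasurableSpace X] {μ : Measure X} {n r : ℕ}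
  {Ds : Fin n → MDerivation X μ} {g : ℕ → X → ℝ}

lemma measurable_derMatrix (hg : ∀ j, IsBddLipschitz (g j)) (ρ : Fin r → Fin n)
    (σ : Fin r → ℕ) (a b : Fin r) : Measurable fun x => derMatrix Ds g ρ σ x a b :=
  (Ds (ρ a)).measurable_D _ (hg _)

lemma injective_rows_of_det_ne_zero {ρ : Fin r → Fin n} {σ : Fin r → ℕ} {x : X}
    (h : (derMatrix Ds g ρ σ x).det ≠ 0) : Function.Injective ρ := by
  intro a b hab
  by_contra hne
  exact h (Matrix.det_zero_of_row_eq hne (by ext; simp [derMatrix, hab]))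

lemma injective_columns_of_det_ne_zero {ρ : Fin r → Fin n} {σ : Fin r → ℕ} {x : X}
    (h : (derMatrix Ds g ρ σ x).det ≠ 0) : Function.Injective σ := by
  intro a b hab
  by_contra hne
  exact h (Matrix.det_zero_of_column_eq hne (by simp [derMatrix, hab]))

lemma linearIndependent_of_det_ne_zero {σ : Fin n → ℕ} {x : X}
    (h : (derMatrix Ds g id σ x).det ≠ 0) :
    LinearIndependent ℝ fun i : Fin n => (fun j : ℕ => (Ds i).D (g j) x : ℕ → ℝ) := by
  have := Matrix.linearIndependent_rows_of_det_ne_zero h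
  exact LinearIndependent.of_comp (LinearMap.funLeft ℝ ℝ σ) this

variable [SigmaFinite μ]

/-- Independent derivations have, on every non-null set, non-degenerate minors of each size. -/
lemma LinIndepDer.exists_minor_ne_zero (hind : LinIndepDer μ Ds)
    (hg : ∀ j, IsBddLipschitz (g j)) (hgen : SeqGenerates (Set.range g))
    {B : Set X} (hB : MeasurableSet B) (hμB : μ B ≠ 0) (hr : r ≤ n) :
    ∃ (ρ : Fin r → Fin n) (σ : Fin r → ℕ),
      μ (B ∩ {x | (derMatrix Ds g ρ σ x).det ≠ 0}) ≠ 0 := by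
  induction r with
  | zero => exact ⟨Fin.elim0, Fin.elim0, by simpa using hμB⟩
  | succ r ih =>
    obtain ⟨ρ, σ, hρσ⟩ := ih (by omega)
    by_contra! hcon
    obtain ⟨k, hk⟩ : ∃ k, ∀ a, ρ a ≠ k := by
      by_contra! hsurj
      have := Fintype.card_le_of_surjective ρ hsurj
      simp at this
      omega
    set ρ' : Fin (r + 1) → Fin n := Fin.cons k ρ
    set m : Fin (r + 1) → X → ℝ := fun a x =>
      (-1) ^ (a : ℕ) * (derMatrix Ds g (ρ' ∘ a.succAbove) σ x).det
    have hm a : Measurable (m a) :=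
      (Measurable.matrix_det (measurable_derMatrix hg _ _)).const_mul _
    have hzero := hind.ae_eq_zero (by rintro _ ⟨j, rfl⟩; exact hg j) hgen
      (fun i => B.indicator fun x => ∑ a, if ρ' a = i then m a x else 0)
      (fun i => (Finset.measurable_sum _ fun a _ => by
        split_ifs
        · exact hm a
        · exact measurable_const).indicator hB) ?_ k
    · refine hρσ (measure_mono_null (fun x hx => ?_) hzero)
      simp only [Set.mem_inter_iff, Set.mem_ofPred_eq] at hx
      have : (∑ a, if ρ' a = k then m a x else 0) = (derMatrix Ds g ρ σ x).det := by
        rw [Fin.sum_univ_succ]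
        simp [ρ', hk, m, Function.comp_def]
      simpa [hx.1, this] using hx.2
    · rintro _ ⟨j, rfl⟩
      have hdet := hcon ρ' (Fin.cons j σ)
      rw [measure_eq_zero_iff_ae_notMem] at hdet
      filter_upwards [hdet] with x hx
      by_cases hxB : x ∈ B
      · have h0 : (derMatrix Ds g ρ' (Fin.cons j σ) x).det = 0 := by
          by_contra h
          exact hx ⟨hxB, h⟩
        rw [Matrix.det_succ_column_zero] at h0
        simp only [Set.indicator_of_mem hxB, Finset.sum_mul, ite_mul, zero_mul]
        rw [Finset.sum_comm]
        refine (Finset.sum_congr rfl fun a _ => ?_).trans h0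
        rw [Finset.sum_ite_eq, if_pos (Finset.mem_univ _), mul_right_comm]
        rfl
      · simp [hxB]

lemma LinIndepDer.ae_exists_det_ne_zero (hind : LinIndepDer μ Ds)
    (hg : ∀ j, IsBddLipschitz (g j)) (hgen : SeqGenerates (Set.range g)) :
    ∀ᵐ x ∂μ, ∃ σ : Fin n → ℕ, (derMatrix Ds g id σ x).det ≠ 0 := by
  by_contra hB
  rw [ae_iff] at hB
  push Not at hB
  have hBm : MeasurableSet {x | ∀ σ : Fin n → ℕ, (derMatrix Ds g id σ x).det = 0} := by
    rw [Set.ofPred_forall]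
    exact MeasurableSet.iInter fun σ =>
      Measurable.matrix_det (measurable_derMatrix hg _ _) (measurableSet_singleton 0)
  obtain ⟨ρ, σ, h⟩ := hind.exists_minor_ne_zero hg hgen hBm hB le_rfl
  obtain ⟨x, hx, hdet⟩ := nonempty_of_measure_ne_zero h
  set e := Equiv.ofBijective ρ (Finite.injective_iff_bijective.1
    (injective_rows_of_det_ne_zero hdet))
  have := Matrix.det_permute e (derMatrix Ds g id σ x)
  rw [hx σ, mul_zero] at this
  exact hdet this

end derMatrix

theorem stmt_17 {X : Type*} [MetricSpace X] [MeasurableSpace X] [BorelSpace X]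
    (μ : Measure X) [SigmaFinite μ] (hμ : μ ≠ 0)
    {n : ℕ} (Ds : Fin n → MDerivation X μ) (hind : LinIndepDer μ Ds)
    (g : ℕ → X → ℝ) (hg : ∀ j, IsBddLipschitz (g j))
    (C : ℝ) (hC : ∀ j, lipNorm (g j) ≤ C)
    (hgen : SeqGenerates (Set.range g)) :
    (∀ᵐ x ∂μ, LinearIndependent ℝ
      fun i : Fin n => (fun j : ℕ => (Ds i).D (g j) x : ℕ → ℝ)) ∧
    ∃ σ : Fin n → ℕ, Function.Injective σ ∧
    ∃ V : Set X, MeasurableSet V ∧ 0 < μ V ∧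
    ∃ a : Fin n → Fin n → X → ℝ,
      (∀ i k, Measurable (a i k)) ∧
      (∀ i k, ∃ B : ℝ, ∀ᵐ x ∂μ.restrict V, |a i k x| ≤ B) ∧
      (∀ᵐ x ∂μ.restrict V, IsUnit (Matrix.of fun i k => a i k x).det) ∧
      ∀ i j, ∀ᵐ x ∂μ.restrict V,
        (∑ k, a i k x * (Ds k).D (g (σ j)) x) = if i = j then 1 else 0 := by
  have hae := hind.ae_exists_det_ne_zero hg hgen
  refine ⟨hae.mono fun x ⟨σ, hσ⟩ => linearIndependent_of_det_ne_zero hσ, ?_⟩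
  set W : (Fin n → ℕ) × ℕ → Set X := fun q =>
    {x | (derMatrix Ds g id q.1 x).det ≠ 0} ∩ ⋂ i, ⋂ k,
      {x | |(derMatrix Ds g id q.1 x)⁻¹ i k| ≤ q.2}
  obtain ⟨⟨σ, N⟩, hpos⟩ : ∃ q, 0 < μ (W q) := by
    refine exists_measure_pos_of_not_measure_iUnion_null fun h0 => hμ ?_
    rw [← ae_eq_bot, ← Filter.eventually_false_iff_eq_bot]
    rw [measure_eq_zero_iff_ae_notMem] at h0
    filter_upwards [hae, h0] with x ⟨σ, hσ⟩ hx
    obtain ⟨N, hN⟩ := exists_nat_ge (∑ i, ∑ k, |(derMatrix Ds g id σ x)⁻¹ i k|)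
    refine hx (Set.mem_iUnion.2 ⟨(σ, N), hσ, ?_⟩)
    simp only [Set.mem_iInter, Set.mem_ofPred_eq]
    intro i k
    calc |(derMatrix Ds g id σ x)⁻¹ i k| ≤ ∑ k, |(derMatrix Ds g id σ x)⁻¹ i k| :=
          Finset.single_le_sum (f := fun k => |(derMatrix Ds g id σ x)⁻¹ i k|)
            (fun _ _ => abs_nonneg _) (Finset.mem_univ k)
      _ ≤ ∑ i, ∑ k, |(derMatrix Ds g id σ x)⁻¹ i k| :=
          Finset.single_le_sum (f := fun i => ∑ k, |(derMatrix Ds g id σ x)⁻¹ i k|)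
            (fun _ _ => by positivity) (Finset.mem_univ i)
      _ ≤ N := hN
  have hinv := Measurable.matrix_inv_apply (measurable_derMatrix (Ds := Ds) hg id σ)
  have hW : MeasurableSet (W (σ, N)) :=
    (Measurable.matrix_det (measurable_derMatrix hg _ _)
      (measurableSet_singleton 0).compl).inter <|
      MeasurableSet.iInter fun i => MeasurableSet.iInter fun k =>
        measurableSet_le (hinv i k).abs measurable_const
  obtain ⟨y, hy⟩ := nonempty_of_measure_ne_zero hpos.ne'
  refine ⟨σ, injective_columns_of_det_ne_zero hy.1, W (σ, N), hW, hpos,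
    fun i k x => (derMatrix Ds g id σ x)⁻¹ i k, hinv, fun i k => ⟨N, ?_⟩, ?_, fun i j => ?_⟩
  all_goals
    filter_upwards [ae_restrict_mem hW] with x hx
  · have := hx.2
    simp only [Set.mem_iInter, Set.mem_ofPred_eq] at this
    exact this i k
  · exact Matrix.isUnit_nonsing_inv_det _ (isUnit_iff_ne_zero.2 hx.1)
  · have := congrFun₂ (Matrix.nonsing_inv_mul _ (isUnit_iff_ne_zero.2 hx.1)) i j
    rwa [Matrix.mul_apply, Matrix.one_apply] at this
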